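/- arXiv:1611.08124 — 4 statements merged into one kernel-verified Lean document; each statement's English description precedes it below -/
import Mathlib

section
/- There exists an absolute constant C > 0 such that for every g ∈ C^∞(T³; ℂ) with ∫_{T³} g dx = 0 there exists u ∈ C^∞(T³; ℂ³) with ∫_{T³} u dx = 0, div u = g on T³, and ‖u‖₀ ≤ C ‖g‖₀. -/
open MeasureTheory

noncomputable section

/-- Functions on the torus T³ = (ℝ/2πℤ)³, modelled as 2π-periodic functions on ℝ³. -/
def periodic3 {E : Type*} (f : (Fin 3 → ℝ) → E) : Prop :=
  ∀ (x : Fin 3 → ℝ) (m : Fin 3 → ℤ), f (fun i => x i + 2 * Real.pi * m i) = f x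

/-- A fundamental domain for T³. -/
def cube3 : Set (Fin 3 → ℝ) := Set.univ.pi fun _ => Set.Ioc 0 (2 * Real.pi)

/-- Partial derivative in the i-th coordinate direction. -/
noncomputable def pd {E : Type*} [NormedAddCommGroup E] [NormedSpace ℝ E]
    (i : Fin 3) (f : (Fin 3 → ℝ) → E) (x : Fin 3 → ℝ) : E :=
  deriv (fun s => f (Function.update x i s)) (x i)

/-- Sup norm. -/
noncomputable def supNorm {α : Type*} {E : Type*} [NormedAddCommGroup E] (f : α → E) : ℝ :=
  ⨆ x, ‖f x‖

universe u

theorem contDiff_intervalIntegral_nat {E : Type u} [NormedAddCommGroup E] [NormedSpace ℝ E]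
    [ProperSpace E] (a b : ℝ) (n : ℕ) :
    ∀ {F : Type u} [NormedAddCommGroup F] [NormedSpace ℝ F] {f : E × ℝ → F},
      ContDiff ℝ n f → ContDiff ℝ n (fun x => ∫ t in a..b, f (x, t)) := by
  induction n with
  | zero =>
    intro F _ _ f hf
    have hf' : Continuous f := hf.continuous
    simp only [Nat.cast_zero, contDiff_zero]
    exact intervalIntegral.continuous_parametric_intervalIntegral_of_continuous' (by fun_prop) a b
  | succ n ih =>
    intro F _ _ f hf
    push_cast at hf ⊢
    obtain ⟨f', hf', hd⟩ := contDiff_succ_iff_hasFDerivAt.1 hf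
    have hfc : Continuous f := hf.continuous
    set G : E × ℝ → E →L[ℝ] F := fun p => (f' p).comp (ContinuousLinearMap.inl ℝ E ℝ) with hG
    have hGn : ContDiff ℝ n G := hf'.clm_comp contDiff_const
    have hGc : Continuous G := hGn.continuous
    refine contDiff_succ_iff_hasFDerivAt.2 ⟨_, ih hGn, fun x₀ => ?_⟩
    obtain ⟨B, hB⟩ := ((isCompact_closedBall x₀ 1).prod
      (isCompact_uIcc (a := a) (b := b))).exists_bound_of_continuousOn hGc.continuousOn
    refine intervalIntegral.hasFDerivAt_integral_of_dominated_of_fderiv_le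
      (F := fun x t => f (x, t)) (F' := fun x t => G (x, t)) (bound := fun _ => B)
      (Metric.closedBall_mem_nhds x₀ one_pos) (.of_forall fun x => ?_) ?_ ?_
      (.of_forall fun t ht x hx => hB (x, t) ⟨hx, Set.uIoc_subset_uIcc ht⟩)
      intervalIntegrable_const (.of_forall fun t _ x _ => ?_)
    · exact (hfc.comp (by fun_prop : Continuous fun t : ℝ => (x, t))).aestronglyMeasurable
    · exact (hfc.comp (by fun_prop : Continuous fun t : ℝ => (x₀, t))).intervalIntegrable _ _
    · exact (hGc.comp (by fun_prop : Continuous fun t : ℝ => (x₀, t))).aestronglyMeasurable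
    · exact (hd (x, t)).comp x (hasFDerivAt_prodMk_left x t)

theorem contDiff_intervalIntegral {E F : Type u} [NormedAddCommGroup E] [NormedSpace ℝ E]
    [ProperSpace E] [NormedAddCommGroup F] [NormedSpace ℝ F] {f : E × ℝ → F} (a b : ℝ)
    (hf : ContDiff ℝ (⊤ : ℕ∞) f) :
    ContDiff ℝ (⊤ : ℕ∞) (fun x => ∫ t in a..b, f (x, t)) :=
  contDiff_infty.2 fun n => contDiff_intervalIntegral_nat a b n (contDiff_infty.1 hf n)

theorem exists_shift_mem_Icc (x : Fin 3 → ℝ) :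
    ∃ m : Fin 3 → ℤ, ∀ i, x i + 2 * Real.pi * m i ∈ Set.Icc 0 (2 * Real.pi) := by
  have hpi : (0 : ℝ) < 2 * Real.pi := by positivity
  refine ⟨fun i => -⌊x i / (2 * Real.pi)⌋, fun i => ?_⟩
  have h1 := (le_div_iff₀ hpi).1 (Int.floor_le (x i / (2 * Real.pi)))
  have h2 := (div_lt_iff₀ hpi).1 (Int.lt_floor_add_one (x i / (2 * Real.pi)))
  push_cast
  constructor <;> linarith

theorem periodic3.exists_norm_le {f : (Fin 3 → ℝ) → ℂ} (hp : periodic3 f)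
    (hf : Continuous f) : ∃ M, ∀ x, ‖f x‖ ≤ M := by
  obtain ⟨M, hM⟩ := (isCompact_univ_pi fun _ : Fin 3 =>
    isCompact_Icc (a := (0 : ℝ)) (b := 2 * Real.pi)).exists_bound_of_continuousOn hf.continuousOn
  refine ⟨M, fun x => ?_⟩
  obtain ⟨m, hm⟩ := exists_shift_mem_Icc x
  rw [← hp x m]
  exact hM _ fun i _ => hm i

/-- The average of `f` along the `i`-th coordinate circle. -/
def coordAvg (i : Fin 3) (f : (Fin 3 → ℝ) → ℂ) (x : Fin 3 → ℝ) : ℂ :=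
  (2 * Real.pi)⁻¹ • ∫ t in (0 : ℝ)..2 * Real.pi, f (Function.update x i t)

/-- The primitive of `f` in the `i`-th coordinate which vanishes on `x i = 0`. -/
def coordPrim (i : Fin 3) (f : (Fin 3 → ℝ) → ℂ) (x : Fin 3 → ℝ) : ℂ :=
  ∫ t in (0 : ℝ)..x i, f (Function.update x i t)

theorem contDiff_update_prod (i : Fin 3) :
    ContDiff ℝ (⊤ : ℕ∞) fun p : (Fin 3 → ℝ) × ℝ => Function.update p.1 i p.2 := by
  refine contDiff_pi.2 fun j => ?_
  by_cases h : j = i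
  · subst h
    simpa using contDiff_snd
  · simp only [Function.update_of_ne h]
    fun_prop

theorem ContDiff.coordAvg {f : (Fin 3 → ℝ) → ℂ} (hf : ContDiff ℝ (⊤ : ℕ∞) f) (i : Fin 3) :
    ContDiff ℝ (⊤ : ℕ∞) (coordAvg i f) :=
  (contDiff_intervalIntegral 0 (2 * Real.pi) (hf.comp (contDiff_update_prod i))).const_smul _

theorem ContDiff.coordPrim {f : (Fin 3 → ℝ) → ℂ} (hf : ContDiff ℝ (⊤ : ℕ∞) f) (i : Fin 3) :
    ContDiff ℝ (⊤ : ℕ∞) (_root_.coordPrim i f) := by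
  have key : _root_.coordPrim i f =
      fun x => x i • ∫ s in (0 : ℝ)..1, f (Function.update x i (s * x i)) := by
    funext x
    rw [intervalIntegral.smul_integral_comp_mul_right (fun t => f (Function.update x i t))]
    simp [_root_.coordPrim]
  rw [key]
  refine ContDiff.smul (contDiff_apply ℝ ℝ i) (contDiff_intervalIntegral 0 1
    (f := fun p : (Fin 3 → ℝ) × ℝ => f (Function.update p.1 i (p.2 * p.1 i))) ?_)
  exact hf.comp ((contDiff_update_prod i).comp
    (by fun_prop : ContDiff ℝ (⊤ : ℕ∞) fun p : (Fin 3 → ℝ) × ℝ => (p.1, p.2 * p.1 i)))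

theorem continuous_comp_update {f : (Fin 3 → ℝ) → ℂ} (hf : Continuous f) (x : Fin 3 → ℝ)
    (i : Fin 3) : Continuous fun t => f (Function.update x i t) := by
  fun_prop

theorem periodic3.apply_update_shift {f : (Fin 3 → ℝ) → ℂ} (hp : periodic3 f) (x : Fin 3 → ℝ)
    (m : Fin 3 → ℤ) (i : Fin 3) (t : ℝ) :
    f (Function.update (fun j => x j + 2 * Real.pi * m j) i t) = f (Function.update x i t) := by
  rw [← hp (Function.update x i t) (Function.update m i 0)]
  congr 1
  funext j
  by_cases h : j = i
  · subst h
    simp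
  · simp [Function.update_of_ne h]

theorem periodic3.coordAvg {f : (Fin 3 → ℝ) → ℂ} (hp : periodic3 f) (i : Fin 3) :
    periodic3 (coordAvg i f) := fun x m => by
  simp only [_root_.coordAvg, hp.apply_update_shift]

theorem periodic3.periodic_update {f : (Fin 3 → ℝ) → ℂ} (hp : periodic3 f) (x : Fin 3 → ℝ)
    (i : Fin 3) : Function.Periodic (fun t => f (Function.update x i t)) (2 * Real.pi) := by
  intro t
  beta_reduce
  rw [← hp (Function.update x i t) (Pi.single i 1)]
  congr 1
  funext j
  by_cases h : j = i
  · subst h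
    simp
  · simp [h]

theorem coordAvg_update_self (f : (Fin 3 → ℝ) → ℂ) (i : Fin 3) (x : Fin 3 → ℝ) (s : ℝ) :
    coordAvg i f (Function.update x i s) = coordAvg i f x := by
  simp [coordAvg]

theorem coordAvg_update {f : (Fin 3 → ℝ) → ℂ} {j : Fin 3}
    (hf : ∀ x s, f (Function.update x j s) = f x) (i : Fin 3) (x : Fin 3 → ℝ) (s : ℝ) :
    coordAvg i f (Function.update x j s) = coordAvg i f x := by
  by_cases h : i = j
  · subst h
    exact coordAvg_update_self f i x s
  · simp only [coordAvg, Function.update_comm (Ne.symm h), hf]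

theorem norm_coordAvg_le {f : (Fin 3 → ℝ) → ℂ} {M : ℝ} (hM : ∀ x, ‖f x‖ ≤ M) (i : Fin 3)
    (x : Fin 3 → ℝ) : ‖coordAvg i f x‖ ≤ M := by
  have h := intervalIntegral.norm_integral_le_of_norm_le_const (a := 0) (b := 2 * Real.pi)
    (f := fun t => f (Function.update x i t)) (C := M) fun t _ => hM _
  have hpi : (0 : ℝ) < 2 * Real.pi := by positivity
  rw [sub_zero, abs_of_pos hpi] at h
  rw [coordAvg, norm_smul, norm_inv, Real.norm_of_nonneg hpi.le, inv_mul_le_iff₀ hpi]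
  linarith

theorem integral_update_sub_coordAvg {f : (Fin 3 → ℝ) → ℂ} (hf : Continuous f) (i : Fin 3)
    (x : Fin 3 → ℝ) :
    ∫ t in (0 : ℝ)..2 * Real.pi,
      (f (Function.update x i t) - coordAvg i f (Function.update x i t)) = 0 := by
  simp only [coordAvg_update_self]
  rw [intervalIntegral.integral_sub ((continuous_comp_update hf x i).intervalIntegrable _ _)
    intervalIntegrable_const, intervalIntegral.integral_const, coordAvg, sub_zero,
    smul_inv_smul₀ (by positivity), sub_self]

theorem periodic3_coordPrim {f : (Fin 3 → ℝ) → ℂ} (hf : Continuous f) (hp : periodic3 f) (i : Fin 3)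
    (h0 : ∀ x, ∫ t in (0 : ℝ)..2 * Real.pi, f (Function.update x i t) = 0) :
    periodic3 (coordPrim i f) := by
  intro x m
  have hc := continuous_comp_update hf x i
  have hper := hp.periodic_update x i
  have hz : ∫ t in x i..x i + 2 * Real.pi * m i, f (Function.update x i t) = 0 := by
    have h := hper.intervalIntegral_add_zsmul_eq (m i) (x i)
      fun a b => hc.intervalIntegrable a b
    rw [hper.intervalIntegral_add_eq (x i) 0, zero_add, h0, smul_zero, zsmul_eq_mul,
      mul_comm] at h
    exact h
  simp only [coordPrim, hp.apply_update_shift]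
  rw [← intervalIntegral.integral_add_adjacent_intervals (hc.intervalIntegrable 0 (x i))
    (hc.intervalIntegrable _ _), hz, add_zero]

theorem norm_coordPrim_le {f : (Fin 3 → ℝ) → ℂ} {M : ℝ} (hM : ∀ x, ‖f x‖ ≤ M) {i : Fin 3}
    (hp : periodic3 (coordPrim i f)) (x : Fin 3 → ℝ) :
    ‖coordPrim i f x‖ ≤ 2 * Real.pi * M := by
  obtain ⟨m, hm⟩ := exists_shift_mem_Icc x
  rw [← hp x m]
  set y : Fin 3 → ℝ := fun i => x i + 2 * Real.pi * m i
  have h := intervalIntegral.norm_integral_le_of_norm_le_const (a := 0) (b := y i)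
    (f := fun t => f (Function.update y i t)) (C := M) fun t _ => hM _
  rw [sub_zero, abs_of_nonneg (hm i).1] at h
  have hM0 : 0 ≤ M := (norm_nonneg _).trans (hM x)
  calc ‖coordPrim i f y‖ ≤ M * y i := h
    _ ≤ M * (2 * Real.pi) := by gcongr; exact (hm i).2
    _ = 2 * Real.pi * M := mul_comm _ _

theorem pd_coordPrim_sub_const {f : (Fin 3 → ℝ) → ℂ} (hf : Continuous f) (i : Fin 3) (c : ℂ)
    (x : Fin 3 → ℝ) : pd i (fun y => coordPrim i f y - c) x = f x := by
  simp only [pd, coordPrim, Function.update_self, Function.update_idem, deriv_sub_const_fun]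
  rw [(continuous_comp_update hf x i).deriv_integral, Function.update_eq_self]

theorem volume_real_cube3 : volume.real cube3 = (2 * Real.pi) ^ 3 := by
  have h := Real.volume_pi_Ioc_toReal (a := fun _ : Fin 3 => (0 : ℝ))
    (b := fun _ => 2 * Real.pi) fun _ => by positivity
  simpa [cube3, Measure.real] using h

theorem volume_cube3_lt_top : volume cube3 < ⊤ := by
  refine lt_top_iff_ne_top.2 fun h => ?_
  have := volume_real_cube3
  rw [Measure.real, h, ENNReal.toReal_top] at this
  have : (0 : ℝ) < (2 * Real.pi) ^ 3 := by positivity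
  linarith

theorem integrableOn_cube3 {E : Type*} [NormedAddCommGroup E] {f : (Fin 3 → ℝ) → E}
    (hf : Continuous f) : IntegrableOn f cube3 :=
  (hf.continuousOn.integrableOn_compact (isCompact_univ_pi fun _ : Fin 3 =>
    isCompact_Icc (a := (0 : ℝ)) (b := 2 * Real.pi))).mono_set
    (Set.pi_mono fun _ _ => Set.Ioc_subset_Icc_self)

theorem setIntegral_cube3_eq {f : (Fin 3 → ℝ) → ℂ} (hf : Continuous f) (i : Fin 3) :
    ∫ x in cube3, f x = ∫ y in Set.univ.pi fun _ : Fin 2 => Set.Ioc 0 (2 * Real.pi),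
      ∫ t in (0 : ℝ)..2 * Real.pi, f (i.insertNth t y) := by
  have hmp := measurePreserving_piFinSuccAbove
    (fun _ : Fin 3 => (volume : Measure ℝ).restrict (Set.Ioc 0 (2 * Real.pi))) i
  have hint := integrableOn_cube3 hf
  rw [IntegrableOn, cube3, volume_pi, Measure.restrict_pi_pi,
    ← hmp.symm.integrable_comp_emb (MeasurableEquiv.measurableEmbedding _)] at hint
  rw [cube3, volume_pi, volume_pi, Measure.restrict_pi_pi, Measure.restrict_pi_pi,
    ← hmp.symm.integral_comp' f]
  refine (integral_prod_symm _ hint).trans (integral_congr_ae (.of_forall fun y => ?_))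
  simp only
  rw [intervalIntegral.integral_of_le (by positivity)]
  rfl

theorem setIntegral_cube3_coordAvg {f : (Fin 3 → ℝ) → ℂ} (hf : ContDiff ℝ (⊤ : ℕ∞) f)
    (i : Fin 3) : ∫ x in cube3, coordAvg i f x = ∫ x in cube3, f x := by
  rw [setIntegral_cube3_eq hf.continuous i, setIntegral_cube3_eq (hf.coordAvg i).continuous i]
  refine integral_congr_ae (.of_forall fun y => ?_)
  simp only [coordAvg, Fin.update_insertNth]
  rw [intervalIntegral.integral_const, sub_zero, smul_inv_smul₀ (by positivity)]

/-- Averaging a mean-zero function over all coordinates gives zero. -/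
theorem coordAvg_coordAvg_coordAvg_eq_zero {g : (Fin 3 → ℝ) → ℂ} (hg : ContDiff ℝ (⊤ : ℕ∞) g)
    (h0 : ∫ x in cube3, g x = 0) (x : Fin 3 → ℝ) :
    coordAvg 0 (coordAvg 1 (coordAvg 2 g)) x = 0 := by
  set h := coordAvg 0 (coordAvg 1 (coordAvg 2 g)) with hh
  have u0 : ∀ x s, h (Function.update x 0 s) = h x := coordAvg_update_self _ 0
  have u1 : ∀ x s, h (Function.update x 1 s) = h x :=
    coordAvg_update (coordAvg_update_self _ 1) 0
  have u2 : ∀ x s, h (Function.update x 2 s) = h x :=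
    coordAvg_update (coordAvg_update (coordAvg_update_self _ 2) 1) 0
  have hconst : ∀ y, h y = h x := fun y => by
    rw [← u0 y (x 0), ← u1 _ (x 1), ← u2 _ (x 2)]
    congr 1
    funext j
    fin_cases j <;> simp [Function.update]
  have hI : ∫ y in cube3, h y = 0 := by
    rw [hh, setIntegral_cube3_coordAvg ((hg.coordAvg 2).coordAvg 1),
      setIntegral_cube3_coordAvg (hg.coordAvg 2), setIntegral_cube3_coordAvg hg, h0]
  simp only [hconst] at hI
  rw [setIntegral_const, volume_real_cube3] at hI
  exact (smul_eq_zero.1 hI).resolve_left (by positivity)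

/-- The mean-zero field whose `i`-th component solves `∂ᵢ uᵢ = f i - coordAvg i (f i)`. -/
theorem exists_field_of_coord {M : ℝ} {f : Fin 3 → (Fin 3 → ℝ) → ℂ}
    (hf : ∀ i, ContDiff ℝ (⊤ : ℕ∞) (f i)) (hp : ∀ i, periodic3 (f i))
    (hM : ∀ i x, ‖f i x‖ ≤ M) :
    ∃ u : (Fin 3 → ℝ) → Fin 3 → ℂ, ContDiff ℝ (⊤ : ℕ∞) u ∧ periodic3 u ∧
      (∫ x in cube3, u x) = 0 ∧
      (∀ i x, pd i (fun y => u y i) x = f i x - coordAvg i (f i) x) ∧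
      ∀ x, ‖u x‖ ≤ 8 * Real.pi * M := by
  have hM0 : 0 ≤ M := (norm_nonneg _).trans (hM 0 0)
  have hpos : (0 : ℝ) < (2 * Real.pi) ^ 3 := by positivity
  set d : Fin 3 → (Fin 3 → ℝ) → ℂ := fun i x => f i x - coordAvg i (f i) x with hd
  have hdc : ∀ i, ContDiff ℝ (⊤ : ℕ∞) (d i) := fun i => (hf i).sub ((hf i).coordAvg i)
  have hdp : ∀ i, periodic3 (d i) := fun i x m => by
    simp only [hd, hp i x m, (hp i).coordAvg i x m]
  have hdM : ∀ i x, ‖d i x‖ ≤ 2 * M := fun i x => by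
    linarith [norm_sub_le (f i x) (coordAvg i (f i) x), hM i x, norm_coordAvg_le (hM i) i x]
  have hvp : ∀ i, periodic3 (coordPrim i (d i)) := fun i =>
    periodic3_coordPrim (hdc i).continuous (hdp i) i (integral_update_sub_coordAvg (hf i).continuous i)
  set v : (Fin 3 → ℝ) → Fin 3 → ℂ := fun x i => coordPrim i (d i) x with hv
  have hvc : ContDiff ℝ (⊤ : ℕ∞) v := contDiff_pi.2 fun i => (hdc i).coordPrim i
  have hvM : ∀ x, ‖v x‖ ≤ 4 * Real.pi * M := fun x =>
    (pi_norm_le_iff_of_nonneg (by positivity)).2 fun i =>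
      (norm_coordPrim_le (hdM i) (hvp i) x).trans_eq (by ring)
  set c : Fin 3 → ℂ := ((2 * Real.pi) ^ 3)⁻¹ • ∫ x in cube3, v x with hc
  have hcM : ‖c‖ ≤ 4 * Real.pi * M := by
    have h := norm_setIntegral_le_of_norm_le_const volume_cube3_lt_top fun x _ => hvM x
    rw [volume_real_cube3] at h
    rw [hc, norm_smul, norm_inv, Real.norm_of_nonneg hpos.le, inv_mul_le_iff₀ hpos]
    linarith
  refine ⟨fun x => v x - c, hvc.sub contDiff_const, fun x m => ?_, ?_,
    fun i x => pd_coordPrim_sub_const (hdc i).continuous i (c i) x, fun x => ?_⟩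
  · simp only [hv, hvp _ x m]
  · rw [integral_sub (integrableOn_cube3 hvc.continuous)
      (integrableOn_cube3 continuous_const), setIntegral_const, volume_real_cube3, hc,
      smul_inv_smul₀ hpos.ne', sub_self]
  · linarith [norm_sub_le (v x) c, hvM x]

/-- there is an absolute constant C such that every smooth mean-zero
g : T³ → ℂ is the divergence of a smooth mean-zero field u : T³ → ℂ³ with
‖u‖₀ ≤ C ‖g‖₀. -/
theorem div_solve_zero_mean :
    ∃ C : ℝ, 0 < C ∧
      ∀ g : (Fin 3 → ℝ) → ℂ, ContDiff ℝ (⊤ : ℕ∞) g → periodic3 g →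
        (∫ x in cube3, g x) = 0 →
        ∃ u : (Fin 3 → ℝ) → Fin 3 → ℂ,
          ContDiff ℝ (⊤ : ℕ∞) u ∧ periodic3 u ∧
          (∫ x in cube3, u x) = 0 ∧
          (∀ x, (∑ i, pd i (fun y => u y i) x) = g x) ∧
          supNorm u ≤ C * supNorm g := by
  refine ⟨8 * Real.pi, by positivity, fun g hg hp h0 => ?_⟩
  obtain ⟨M, hM⟩ := hp.exists_norm_le hg.continuous
  have hM' : ∀ x, ‖g x‖ ≤ supNorm g :=
    le_ciSup (f := fun x => ‖g x‖) ⟨M, Set.forall_mem_range.2 hM⟩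
  obtain ⟨u, hu, hup, hu0, hd, hb⟩ := exists_field_of_coord (M := supNorm g)
    (f := ![coordAvg 1 (coordAvg 2 g), coordAvg 2 g, g])
    (Fin.forall_fin_succ.2 ⟨(hg.coordAvg 2).coordAvg 1,
      Fin.forall_fin_two.2 ⟨hg.coordAvg 2, hg⟩⟩)
    (Fin.forall_fin_succ.2 ⟨(hp.coordAvg 2).coordAvg 1,
      Fin.forall_fin_two.2 ⟨hp.coordAvg 2, hp⟩⟩)
    (Fin.forall_fin_succ.2 ⟨norm_coordAvg_le (norm_coordAvg_le hM' 2) 1,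
      Fin.forall_fin_two.2 ⟨norm_coordAvg_le hM' 2, hM'⟩⟩)
  refine ⟨u, hu, hup, hu0, fun x => ?_, ciSup_le hb⟩
  have hz := coordAvg_coordAvg_coordAvg_eq_zero hg h0 x
  simp only [hd, Fin.sum_univ_three, Matrix.cons_val, hz]
  ring
end
end

section
/- Let M > 0, let λ be a positive integer, and let χ ∈ C_c^∞((1,4)) with 0 ≤ χ ≤ 1. Define on ℝ×T³: v₀(t,x,y,z) = 10Mχ(t)(cos(λy), 0, 0)ᵀ, θ₀ = 10Mχ(t)cos(λy), p₀ = 10Mχ′(t)sin(λz)/λ, R₀ = 10M times the symmetric matrix with entries R₁₁ = 0, R₁₂ = χ′(t)sin(λy)/λ, R₁₃ = 0, R₂₂ = 0, R₂₃ = −χ(t)sin(λy)/λ, R₃₃ = χ′(t)sin(λz)/λ, and f₀ = 10Mχ′(t)(0, sin(λy)/λ, 0)ᵀ. Then (v₀, p₀, θ₀, R₀, f₀) are smooth, vanish for t outside (1,4), solve the Boussinesq–Stress system, and satisfy ‖R₀‖₀ ≤ 10M(‖χ′‖₀ + 1)/λ and ‖f₀‖₀ ≤ 10M‖χ′‖₀/λ.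 -/
open MeasureTheory

noncomputable section

/-- Space-time ℝ × ℝ³; spatial functions are 2π-periodic, modelling ℝ × T³. -/
abbrev SpaceTime := ℝ × (Fin 3 → ℝ)

/-- 2π-periodicity in each spatial variable. -/
def stPeriodic {E : Type*} (f : SpaceTime → E) : Prop :=
  ∀ (t : ℝ) (x : Fin 3 → ℝ) (m : Fin 3 → ℤ),
    f (t, fun i => x i + 2 * Real.pi * m i) = f (t, x)

/-- Time derivative. -/
noncomputable def tderiv {E : Type*} [NormedAddCommGroup E] [NormedSpace ℝ E]
    (f : SpaceTime → E) (q : SpaceTime) : E :=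
  deriv (fun s => f (s, q.2)) q.1

/-- Spatial partial derivative in direction i (i = 0,1,2 for x,y,z). -/
noncomputable def sderiv {E : Type*} [NormedAddCommGroup E] [NormedSpace ℝ E]
    (i : Fin 3) (f : SpaceTime → E) (q : SpaceTime) : E :=
  deriv (fun s => f (q.1, Function.update q.2 i s)) (q.2 i)

/-- The Boussinesq–Stress system:
∂_t v + div(v⊗v) + ∇p − ∂_zz v = θe₃ + div R, div v = 0,
∂_t θ + div(vθ) − ∂_zz θ = div f. -/
def BoussStress (v : SpaceTime → Fin 3 → ℝ) (p θ : SpaceTime → ℝ)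
    (R : SpaceTime → Fin 3 → Fin 3 → ℝ) (f : SpaceTime → Fin 3 → ℝ) : Prop :=
  (∀ (q : SpaceTime) (i : Fin 3),
    tderiv (fun r => v r i) q
      + (∑ j, sderiv j (fun r => v r i * v r j) q)
      + sderiv i p q
      - sderiv 2 (sderiv 2 fun r => v r i) q
      = θ q * (if i = 2 then 1 else 0) + ∑ j, sderiv j (fun r => R r i j) q) ∧
  (∀ q : SpaceTime, (∑ i, sderiv i (fun r => v r i) q) = 0) ∧
  (∀ q : SpaceTime,
    tderiv θ q + (∑ j, sderiv j (fun r => v r j * θ r) q)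
      - sderiv 2 (sderiv 2 θ) q
      = ∑ j, sderiv j (fun r => f r j) q)

/-- v₀ = 10Mχ(t)(cos(λy), 0, 0)ᵀ. -/
noncomputable def v0 (M : ℝ) (lam : ℕ) (χ : ℝ → ℝ) : SpaceTime → Fin 3 → ℝ :=
  fun q => ![10 * M * χ q.1 * Real.cos (lam * q.2 1), 0, 0]

/-- θ₀ = 10Mχ(t)cos(λy). -/
noncomputable def θ0 (M : ℝ) (lam : ℕ) (χ : ℝ → ℝ) : SpaceTime → ℝ :=
  fun q => 10 * M * χ q.1 * Real.cos (lam * q.2 1)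

/-- p₀ = 10Mχ′(t)sin(λz)/λ. -/
noncomputable def p0 (M : ℝ) (lam : ℕ) (χ : ℝ → ℝ) : SpaceTime → ℝ :=
  fun q => 10 * M * deriv χ q.1 * Real.sin (lam * q.2 2) / lam

/-- R₀ with R₁₂ = R₂₁ = χ′(t)sin(λy)/λ, R₂₃ = R₃₂ = −χ(t)sin(λy)/λ,
R₃₃ = χ′(t)sin(λz)/λ, other entries 0, all multiplied by 10M. -/
noncomputable def R0 (M : ℝ) (lam : ℕ) (χ : ℝ → ℝ) : SpaceTime → Fin 3 → Fin 3 → ℝ :=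
  fun q =>
    ![![0, 10 * M * deriv χ q.1 * Real.sin (lam * q.2 1) / lam, 0],
      ![10 * M * deriv χ q.1 * Real.sin (lam * q.2 1) / lam, 0,
        -(10 * M * χ q.1 * Real.sin (lam * q.2 1) / lam)],
      ![0, -(10 * M * χ q.1 * Real.sin (lam * q.2 1) / lam),
        10 * M * deriv χ q.1 * Real.sin (lam * q.2 2) / lam]]

/-- f₀ = 10Mχ′(t)(0, sin(λy)/λ, 0)ᵀ. -/
noncomputable def f0 (M : ℝ) (lam : ℕ) (χ : ℝ → ℝ) : SpaceTime → Fin 3 → ℝ :=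
  fun q => ![0, 10 * M * deriv χ q.1 * Real.sin (lam * q.2 1) / lam, 0]

theorem deriv_eq_zero_of_nonneg_of_eq_zero {χ : ℝ → ℝ} (hχ0 : ∀ t, 0 ≤ χ t) {t : ℝ}
    (ht : χ t = 0) : deriv χ t = 0 :=
  IsLocalMin.deriv_eq_zero (Filter.Eventually.of_forall fun s => ht ▸ hχ0 s)

theorem bddAbove_norm_of_eq_zero_off_Ioo {g : ℝ → ℝ} (hg : Continuous g) {a b : ℝ}
    (h : ∀ t, t ∉ Set.Ioo a b → g t = 0) : BddAbove (Set.range fun t => ‖g t‖) := by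
  obtain ⟨C, hC⟩ := isCompact_Icc.exists_bound_of_continuousOn (s := Set.Icc a b) hg.continuousOn
  refine ⟨max C 0, ?_⟩
  rintro _ ⟨t, rfl⟩
  by_cases ht : t ∈ Set.Ioo a b
  · exact (hC t (Set.Ioo_subset_Icc_self ht)).trans (le_max_left _ _)
  · simp [h t ht]

theorem sin_natCast_mul_add_int (n : ℕ) (x : ℝ) (m : ℤ) :
    Real.sin (n * (x + 2 * Real.pi * m)) = Real.sin (n * x) := by
  rw [← Real.sin_add_int_mul_two_pi (n * x) (n * m)]
  push_cast
  ring_nf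

theorem cos_natCast_mul_add_int (n : ℕ) (x : ℝ) (m : ℤ) :
    Real.cos (n * (x + 2 * Real.pi * m)) = Real.cos (n * x) := by
  rw [← Real.cos_add_int_mul_two_pi (n * x) (n * m)]
  push_cast
  ring_nf

theorem deriv_mul_sin_div (a l x : ℝ) (hl : l ≠ 0) :
    deriv (fun s => a * Real.sin (l * s) / l) x = a * Real.cos (l * x) := by
  have h := ((((hasDerivAt_id x).const_mul l).sin).const_mul a).div_const l
  refine Eq.trans (h.deriv) ?_
  simp only [id]
  field_simp

theorem abs_mul_mul_sin_div_le {M l a C : ℝ} (x : ℝ) (hM : 0 < M) (hl : 0 < l) (ha : |a| ≤ C) :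
    |10 * M * a * Real.sin x / l| ≤ 10 * M * C / l := by
  rw [abs_div, abs_mul, abs_mul, abs_of_pos hl, abs_of_pos (by positivity : 0 < 10 * M)]
  have h1 := Real.abs_sin_le_one x
  have h2 : |a| * |Real.sin x| ≤ C := by nlinarith [abs_nonneg a, abs_nonneg (Real.sin x)]
  have h3 : 10 * M * |a| * |Real.sin x| ≤ 10 * M * C := by
    rw [mul_assoc]
    gcongr
  gcongr

/-- the explicit initial tuple (v₀, p₀, θ₀, R₀, f₀) is smooth, vanishes
for t outside (1,4), solves the Boussinesq–Stress system, and satisfies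
‖R₀‖₀ ≤ 10M(‖χ′‖₀ + 1)/λ and ‖f₀‖₀ ≤ 10M‖χ′‖₀/λ. -/
theorem initial_tuple_properties (M : ℝ) (hM : 0 < M) (lam : ℕ) (hlam : 0 < lam)
    (χ : ℝ → ℝ) (hχ : ContDiff ℝ (⊤ : ℕ∞) χ)
    (hsupp : ∀ t, t ∉ Set.Ioo (1 : ℝ) 4 → χ t = 0)
    (hχ0 : ∀ t, 0 ≤ χ t) (hχ1 : ∀ t, χ t ≤ 1) :
    ContDiff ℝ (⊤ : ℕ∞) (v0 M lam χ) ∧ ContDiff ℝ (⊤ : ℕ∞) (p0 M lam χ) ∧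
    ContDiff ℝ (⊤ : ℕ∞) (θ0 M lam χ) ∧ ContDiff ℝ (⊤ : ℕ∞) (R0 M lam χ) ∧
    ContDiff ℝ (⊤ : ℕ∞) (f0 M lam χ) ∧
    stPeriodic (v0 M lam χ) ∧ stPeriodic (p0 M lam χ) ∧ stPeriodic (θ0 M lam χ) ∧
    stPeriodic (R0 M lam χ) ∧ stPeriodic (f0 M lam χ) ∧
    (∀ t x, t ∉ Set.Ioo (1 : ℝ) 4 →
      v0 M lam χ (t, x) = 0 ∧ p0 M lam χ (t, x) = 0 ∧ θ0 M lam χ (t, x) = 0 ∧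
      R0 M lam χ (t, x) = 0 ∧ f0 M lam χ (t, x) = 0) ∧
    (∀ q i j, R0 M lam χ q i j = R0 M lam χ q j i) ∧
    BoussStress (v0 M lam χ) (p0 M lam χ) (θ0 M lam χ) (R0 M lam χ) (f0 M lam χ) ∧
    supNorm (R0 M lam χ) ≤ 10 * M * (supNorm (deriv χ) + 1) / lam ∧
    supNorm (f0 M lam χ) ≤ 10 * M * supNorm (deriv χ) / lam := by
  have hl : (0 : ℝ) < lam := by exact_mod_cast hlam
  have hd : ContDiff ℝ (⊤ : ℕ∞) (deriv χ) := (contDiff_infty_iff_deriv.1 hχ).2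
  have hdsupp : ∀ t, t ∉ Set.Ioo (1 : ℝ) 4 → deriv χ t = 0 := fun t ht =>
    deriv_eq_zero_of_nonneg_of_eq_zero hχ0 (hsupp t ht)
  have hbdd := bddAbove_norm_of_eq_zero_off_Ioo hd.continuous hdsupp
  have hle : ∀ t, |deriv χ t| ≤ supNorm (deriv χ) := fun t => le_ciSup hbdd t
  have hnn : 0 ≤ supNorm (deriv χ) := (abs_nonneg _).trans (hle 0)
  have hle' : ∀ t, |deriv χ t| ≤ supNorm (deriv χ) + 1 := fun t => (hle t).trans (by linarith)
  have hχle : ∀ t, |χ t| ≤ supNorm (deriv χ) + 1 := fun t => by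
    rw [abs_of_nonneg (hχ0 t)]
    linarith [hχ1 t]
  have hχd : ∀ t, DifferentiableAt ℝ χ t := (hχ.differentiable (by simp))
  have hC : ContDiff ℝ (⊤ : ℕ∞) fun q : SpaceTime =>
      10 * M * χ q.1 * Real.cos (lam * q.2 1) := by fun_prop
  have hS : ContDiff ℝ (⊤ : ℕ∞) fun q : SpaceTime =>
      10 * M * χ q.1 * Real.sin (lam * q.2 1) / lam := by fun_prop
  have hS' : ∀ i : Fin 3, ContDiff ℝ (⊤ : ℕ∞) fun q : SpaceTime =>
      10 * M * deriv χ q.1 * Real.sin (lam * q.2 i) / lam := fun i => by fun_prop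
  have h0 : ContDiff ℝ (⊤ : ℕ∞) fun _ : SpaceTime => (0 : ℝ) := contDiff_const
  refine ⟨?_, hS' 2, hC, ?_, ?_, ?_, ?_, ?_, ?_, ?_, ?_, ?_, ⟨?_, ?_, ?_⟩, ?_, ?_⟩
  · refine contDiff_pi.2 fun i => ?_
    fin_cases i
    exacts [hC, h0, h0]
  · refine contDiff_pi.2 fun i => contDiff_pi.2 fun j => ?_
    fin_cases i <;> fin_cases j
    exacts [h0, hS' 1, h0, hS' 1, h0, hS.neg, h0, hS.neg, hS' 2]
  · refine contDiff_pi.2 fun i => ?_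
    fin_cases i
    exacts [h0, hS' 1, h0]
  · intro t x m
    simp only [v0, cos_natCast_mul_add_int]
  · intro t x m
    simp only [p0, sin_natCast_mul_add_int]
  · intro t x m
    simp only [θ0, cos_natCast_mul_add_int]
  · intro t x m
    simp only [R0, sin_natCast_mul_add_int]
  · intro t x m
    simp only [f0, sin_natCast_mul_add_int]
  · intro t x ht
    refine ⟨?_, ?_, ?_, ?_, ?_⟩
    · ext i
      fin_cases i <;> simp [v0, hsupp t ht]
    · simp [p0, hdsupp t ht]
    · simp [θ0, hsupp t ht]
    · ext i j
      fin_cases i <;> fin_cases j <;> simp [R0, hsupp t ht, hdsupp t ht]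
    · ext i
      fin_cases i <;> simp [f0, hdsupp t ht]
  · intro q i j
    fin_cases i <;> fin_cases j <;> rfl
  · rintro ⟨t, x⟩ i
    fin_cases i <;>
      simp [tderiv, sderiv, v0, p0, θ0, R0, Fin.sum_univ_three, Function.update_apply,
        deriv_mul_sin_div _ _ _ hl.ne', hχd t]
  · rintro ⟨t, x⟩
    simp [sderiv, v0, Fin.sum_univ_three, Function.update_apply]
  · rintro ⟨t, x⟩
    simp [tderiv, sderiv, v0, θ0, f0, Fin.sum_univ_three, Function.update_apply,
      deriv_mul_sin_div _ _ _ hl.ne', hχd t]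
  · have hB : 0 ≤ 10 * M * (supNorm (deriv χ) + 1) / lam := by positivity
    refine ciSup_le fun q => ?_
    refine (pi_norm_le_iff_of_nonneg hB).2 fun i => (pi_norm_le_iff_of_nonneg hB).2 fun j => ?_
    have h1 := fun x => abs_mul_mul_sin_div_le x hM hl (hle' q.1)
    have h2 := fun x => abs_mul_mul_sin_div_le x hM hl (hχle q.1)
    have h2' := fun x => (abs_neg _).trans_le (h2 x)
    have hB0 : ‖(0 : ℝ)‖ ≤ 10 * M * (supNorm (deriv χ) + 1) / lam := by rwa [norm_zero]
    fin_cases i <;> fin_cases j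
    exacts [hB0, h1 _, hB0, h1 _, hB0, h2' _, hB0, h2' _, h1 _]
  · have hB : 0 ≤ 10 * M * supNorm (deriv χ) / lam := by positivity
    refine ciSup_le fun q => (pi_norm_le_iff_of_nonneg hB).2 fun i => ?_
    have h1 := fun x => abs_mul_mul_sin_div_le x hM hl (hle q.1)
    have hB0 : ‖(0 : ℝ)‖ ≤ 10 * M * supNorm (deriv χ) / lam := by rwa [norm_zero]
    fin_cases i
    exacts [hB0, h1 _, hB0]
end
end

section
/- Let b : ℝ³ → ℝ be smooth, let k = (k₁,k₂,k₃) ∈ ℝ³ with (k₁,k₂) ≠ (0,0), let s, t ∈ ℝ satisfy s k₁ + t k₂ = −k₃, set ξ := (−k₂, k₁, 0), and let λ ≠ 0 be real. Then, writing φ(x,y,z) = e^{iλ ξ·(x,y,z)}, one has the identity curl( b · (s, t, 1)ᵀ · φ / (iλ) ) = b k φ + (1/(iλ)) ( ∂_y b − t ∂_z b, s ∂_z b − ∂_x b, t ∂_x b − s ∂_y b )ᵀ φ, where curl acts componentwise on real and imaginary parts. In particular, the vector field on the right-hand side is divergence-free. -/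
noncomputable section

open Complex

/-- curl of a ℂ³-valued vector field on ℝ³. -/
noncomputable def curl3 (u : (Fin 3 → ℝ) → Fin 3 → ℂ) (x : Fin 3 → ℝ) : Fin 3 → ℂ :=
  ![pd 1 (fun y => u y 2) x - pd 2 (fun y => u y 1) x,
    pd 2 (fun y => u y 0) x - pd 0 (fun y => u y 2) x,
    pd 0 (fun y => u y 1) x - pd 1 (fun y => u y 0) x]

theorem hasDerivAt_comp_update {E : Type*} [NormedAddCommGroup E] [NormedSpace ℝ E]
    {f : (Fin 3 → ℝ) → E} {x : Fin 3 → ℝ} (hf : DifferentiableAt ℝ f x) (i : Fin 3) :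
    HasDerivAt (fun s => f (Function.update x i s)) (fderiv ℝ f x (Pi.single i 1)) (x i) := by
  have hf' : HasFDerivAt f (fderiv ℝ f x) (Function.update x i (x i)) := by
    rw [Function.update_eq_self]
    exact hf.hasFDerivAt
  exact hf'.comp_hasDerivAt (x i) (hasDerivAt_update x i (x i))

theorem pd_eq_fderiv {E : Type*} [NormedAddCommGroup E] [NormedSpace ℝ E]
    {f : (Fin 3 → ℝ) → E} {x : Fin 3 → ℝ} (hf : DifferentiableAt ℝ f x) (i : Fin 3) :
    pd i f x = fderiv ℝ f x (Pi.single i 1) :=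
  (hasDerivAt_comp_update hf i).deriv

theorem pd_sub {E : Type*} [NormedAddCommGroup E] [NormedSpace ℝ E]
    {f g : (Fin 3 → ℝ) → E} {x : Fin 3 → ℝ} (hf : DifferentiableAt ℝ f x)
    (hg : DifferentiableAt ℝ g x) (i : Fin 3) :
    pd i (fun y => f y - g y) x = pd i f x - pd i g x :=
  ((pd_eq_fderiv hf i).symm ▸ (pd_eq_fderiv hg i).symm ▸
    ((hasDerivAt_comp_update hf i).sub (hasDerivAt_comp_update hg i)).deriv)

theorem pd_eq_fderiv_fun {E : Type*} [NormedAddCommGroup E] [NormedSpace ℝ E]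
    {f : (Fin 3 → ℝ) → E} (hf : ContDiff ℝ 2 f) (i : Fin 3) :
    pd i f = fun x => fderiv ℝ f x (Pi.single i 1) :=
  funext fun x => pd_eq_fderiv (hf.differentiable (by norm_num) x) i

theorem differentiable_pd {E : Type*} [NormedAddCommGroup E] [NormedSpace ℝ E]
    {f : (Fin 3 → ℝ) → E} (hf : ContDiff ℝ 2 f) (i : Fin 3) : Differentiable ℝ (pd i f) := by
  rw [pd_eq_fderiv_fun hf i]
  have h : Differentiable ℝ (fderiv ℝ f) :=
    (hf.fderiv_right (m := 1) (by norm_num)).differentiable (by norm_num)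
  fun_prop

theorem pd_comm {E : Type*} [NormedAddCommGroup E] [NormedSpace ℝ E]
    {f : (Fin 3 → ℝ) → E} (hf : ContDiff ℝ 2 f) (i j : Fin 3) (x : Fin 3 → ℝ) :
    pd i (pd j f) x = pd j (pd i f) x := by
  have h : Differentiable ℝ (fderiv ℝ f) :=
    (hf.fderiv_right (m := 1) (by norm_num)).differentiable (by norm_num)
  have second (i j : Fin 3) :
      pd i (pd j f) x = fderiv ℝ (fderiv ℝ f) x (Pi.single i 1) (Pi.single j 1) := by
    rw [pd_eq_fderiv (differentiable_pd hf j x), pd_eq_fderiv_fun hf j,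
      fderiv_clm_apply (h x) (differentiableAt_const _)]
    simp
  rw [second, second]
  exact (hf.contDiffAt.isSymmSndFDerivAt (by simp)).eq _ _

theorem sum_pd_curl3 {u : (Fin 3 → ℝ) → Fin 3 → ℂ}
    (hu : ∀ j, ContDiff ℝ 2 (fun y => u y j)) (x : Fin 3 → ℝ) :
    ∑ j, pd j (fun y => curl3 u y j) x = 0 := by
  have hd (i j : Fin 3) : DifferentiableAt ℝ (pd i fun y => u y j) x :=
    differentiable_pd (hu j) i x
  simp only [Fin.sum_univ_three, curl3, Matrix.cons_val]
  rw [pd_sub (hd _ _) (hd _ _), pd_sub (hd _ _) (hd _ _), pd_sub (hd _ _) (hd _ _),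
    pd_comm (hu 2) 0 1, pd_comm (hu 1) 0 2, pd_comm (hu 0) 1 2]
  ring

theorem pd_mul_exp {b : (Fin 3 → ℝ) → ℝ} {x : Fin 3 → ℝ} (hb : DifferentiableAt ℝ b x)
    (c : ℂ) (ξ : Fin 3 → ℝ) {μ : ℂ} (hμ : μ ≠ 0) (i : Fin 3) :
    pd i (fun y => ((b y : ℂ) * c * Complex.exp (μ * ∑ j, (ξ j : ℂ) * (y j : ℂ))) / μ) x =
      (1 / μ * ((pd i b x : ℝ) : ℂ) + (b x : ℂ) * (ξ i : ℂ)) * c *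
        Complex.exp (μ * ∑ j, (ξ j : ℂ) * (x j : ℂ)) := by
  have hB := (hasDerivAt_comp_update hb i).ofReal_comp
  have hφ : HasDerivAt (fun s : ℝ => ∑ j, (ξ j : ℂ) * (Function.update x i s j : ℂ))
      (∑ j, (ξ j : ℂ) * ((Pi.single i 1 : Fin 3 → ℝ) j : ℂ)) (x i) :=
    HasDerivAt.fun_sum fun j _ =>
      ((hasDerivAt_pi.1 (hasDerivAt_update x i (x i)) j).ofReal_comp).const_mul _
  have hsum : ∑ j, (ξ j : ℂ) * ((Pi.single i 1 : Fin 3 → ℝ) j : ℂ) = ξ i := by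
    simp [Pi.single_apply, apply_ite Complex.ofReal]
  rw [hsum] at hφ
  have h := (((hB.mul_const c).mul (hφ.const_mul μ).cexp).div_const μ).deriv
  rw [← pd_eq_fderiv hb i] at h
  refine h.trans ?_
  simp only [Function.update_eq_self]
  field_simp

/-- with ξ = (−k₂, k₁, 0), φ = e^{iλξ·x} and s k₁ + t k₂ = −k₃,
curl(b (s,t,1)ᵀ φ/(iλ)) = b k φ + (1/(iλ))(∂_y b − t∂_z b, s∂_z b − ∂_x b,
t∂_x b − s∂_y b)ᵀ φ; in particular the right-hand side is divergence-free. -/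
theorem curl_ansatz_identity (b : (Fin 3 → ℝ) → ℝ) (hb : ContDiff ℝ (⊤ : ℕ∞) b)
    (k : Fin 3 → ℝ) (hk : ¬(k 0 = 0 ∧ k 1 = 0)) (s t : ℝ)
    (hst : s * k 0 + t * k 1 = -(k 2)) (lam : ℝ) (hlam : lam ≠ 0) :
    -- the phase and the vector field
    (∀ x : Fin 3 → ℝ,
      curl3 (fun y j => ((b y : ℂ) * (![(s : ℂ), (t : ℂ), 1] j)
          * Complex.exp (Complex.I * (lam : ℂ) *
              (∑ i, ((![-(k 1), k 0, 0] : Fin 3 → ℝ) i : ℂ) * (y i : ℂ))))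
          / (Complex.I * (lam : ℂ))) x
        = fun j => (b x : ℂ) * (k j : ℂ)
              * Complex.exp (Complex.I * (lam : ℂ) *
                  (∑ i, ((![-(k 1), k 0, 0] : Fin 3 → ℝ) i : ℂ) * (x i : ℂ)))
            + (1 / (Complex.I * (lam : ℂ)))
              * ((![pd 1 b x - t * pd 2 b x,
                    s * pd 2 b x - pd 0 b x,
                    t * pd 0 b x - s * pd 1 b x] : Fin 3 → ℝ) j : ℂ)
              * Complex.exp (Complex.I * (lam : ℂ) *
                  (∑ i, ((![-(k 1), k 0, 0] : Fin 3 → ℝ) i : ℂ) * (x i : ℂ)))) ∧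
    (∀ x : Fin 3 → ℝ,
      (∑ j, pd j (fun y =>
        (b y : ℂ) * (k j : ℂ)
            * Complex.exp (Complex.I * (lam : ℂ) *
                (∑ i, ((![-(k 1), k 0, 0] : Fin 3 → ℝ) i : ℂ) * (y i : ℂ)))
          + (1 / (Complex.I * (lam : ℂ)))
            * ((![pd 1 b y - t * pd 2 b y,
                  s * pd 2 b y - pd 0 b y,
                  t * pd 0 b y - s * pd 1 b y] : Fin 3 → ℝ) j : ℂ)
            * Complex.exp (Complex.I * (lam : ℂ) *
                (∑ i, ((![-(k 1), k 0, 0] : Fin 3 → ℝ) i : ℂ) * (y i : ℂ)))) x) = 0) := by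
  have hμ : Complex.I * (lam : ℂ) ≠ 0 :=
    mul_ne_zero Complex.I_ne_zero (Complex.ofReal_ne_zero.2 hlam)
  have hk2 : (k 2 : ℂ) = -((s : ℂ) * k 0 + t * k 1) := by
    rw [← neg_eq_iff_eq_neg]
    exact_mod_cast hst.symm
  refine (and_iff_left_of_imp fun hcurl x => ?_).2 fun x => ?_
  · simp only [← congr_fun (hcurl _)]
    refine sum_pd_curl3 (fun j => ?_) x
    have hb2 : ContDiff ℝ 2 fun y => (b y : ℂ) :=
      Complex.ofRealCLM.contDiff.comp (contDiff_infty.1 hb 2)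
    have hcoord (i : Fin 3) : ContDiff ℝ 2 fun y : Fin 3 → ℝ => (y i : ℂ) :=
      Complex.ofRealCLM.contDiff.comp (contDiff_apply ℝ ℝ i)
    fun_prop
  · have hbx : DifferentiableAt ℝ b x := hb.differentiable (by simp) x
    simp only [curl3, pd_mul_exp hbx _ _ hμ]
    ext j
    fin_cases j <;> simp [hk2] <;> ring
end
end

section
/- Let a > 1, b > 1, c > 0, M > 0 and let 0 < α < 1/(1 + 2bc). Let (u_n)_{n≥0} be a sequence of functions from a metric space X to a complete normed space E such that for every n: sup_X ‖u_{n+1} − u_n‖ ≤ M a^{−bⁿ/2} and u_{n+1} − u_n is Lipschitz with constant at most 2 a^{c b^{n+1}}. Then there is a constant C (depending only on M and α) such that the Hölder-α seminorm of u_{n+1} − u_n is at most C a^{(αcb − (1−α)/2) bⁿ}; moreover αcb − (1−α)/2 < 0, the series of these seminorms converges, and consequently (u_n) converges uniformly to a limit u which is α-Hölder continuous on X (i.e., has finite Hölder-α seminorm), provided u₀ is α-Hölder continuous. -/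
noncomputable section

open Filter Finset

theorem summable_rpow_mul_pow_of_neg {a b s : ℝ} (ha : 1 < a) (hb : 1 < b) (hs : s < 0) :
    Summable fun n : ℕ => a ^ (s * b ^ n) := by
  have ha0 : 0 < a := one_pos.trans ha
  have hgeom : Summable fun n : ℕ => a ^ s * (a ^ (s * (b - 1))) ^ n :=
    (summable_geometric_of_lt_one (by positivity)
      (Real.rpow_lt_one_of_one_lt_of_neg ha
        (mul_neg_of_neg_of_pos hs (sub_pos.2 hb)))).mul_left _
  refine hgeom.of_nonneg_of_le (fun n => by positivity) fun n => ?_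
  rw [← Real.rpow_mul_natCast ha0.le, ← Real.rpow_add ha0]
  refine Real.rpow_le_rpow_of_exponent_le ha.le ?_
  have hbern : 1 + (n : ℝ) * (b - 1) ≤ b ^ n := by
    simpa using one_add_mul_le_pow (a := b - 1) (by linarith) n
  nlinarith

theorem norm_sub_le_of_bounded_of_lipschitz {X E : Type*} [PseudoMetricSpace X]
    [SeminormedAddCommGroup E] {f : X → E} {K L α : ℝ} (hL : 0 ≤ L)
    (hα0 : 0 ≤ α) (hα1 : α ≤ 1) (hK : ∀ x, ‖f x‖ ≤ K)
    (hf : ∀ x y, ‖f x - f y‖ ≤ L * dist x y) (x y : X) :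
    ‖f x - f y‖ ≤ (2 * K) ^ (1 - α) * L ^ α * dist x y ^ α := by
  have hbound : ‖f x - f y‖ ≤ 2 * K := by
    linarith [norm_sub_le (f x) (f y), hK x, hK y]
  calc ‖f x - f y‖ = ‖f x - f y‖ ^ (1 - α) * ‖f x - f y‖ ^ α := by
        rw [← Real.rpow_add_of_nonneg (norm_nonneg _) (sub_nonneg.2 hα1) hα0,
          sub_add_cancel, Real.rpow_one]
    _ ≤ (2 * K) ^ (1 - α) * (L * dist x y) ^ α := by
        gcongr
        exacts [Real.rpow_nonneg ((norm_nonneg _).trans hbound) _, hf x y]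
    _ = (2 * K) ^ (1 - α) * L ^ α * dist x y ^ α := by
        rw [Real.mul_rpow hL dist_nonneg, mul_assoc]

theorem exists_tendstoUniformly_of_norm_sub_le {X E : Type*} [NormedAddCommGroup E]
    [CompleteSpace E] {u : ℕ → X → E} {r : ℕ → ℝ} (hr : Summable r)
    (hu : ∀ n x, ‖u (n + 1) x - u n x‖ ≤ r n) :
    ∃ v : X → E, TendstoUniformly u v atTop := by
  refine ⟨fun x => u 0 x + ∑' n, (u (n + 1) x - u n x), ?_⟩
  have h := tendstoUniformly_tsum_nat hr hu
  rw [Metric.tendstoUniformly_iff] at h ⊢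
  intro ε hε
  filter_upwards [h ε hε] with N hN x
  have hsum : u N x = u 0 x + ∑ n ∈ range N, (u (n + 1) x - u n x) := by
    rw [sum_range_sub (fun n => u n x), add_sub_cancel]
  rw [hsum, dist_add_left]
  exact hN x

theorem norm_sub_le_of_tendsto_of_summable {X E : Type*} [PseudoMetricSpace X]
    [SeminormedAddCommGroup E] {u : ℕ → X → E} {v : X → E} {h : ℕ → ℝ} {K α : ℝ}
    (hh : Summable h) (hh0 : ∀ n, 0 ≤ h n)
    (huv : ∀ x, Tendsto (fun n => u n x) atTop (nhds (v x)))
    (hu : ∀ n x y, ‖(u (n + 1) x - u n x) - (u (n + 1) y - u n y)‖ ≤ h n * dist x y ^ α)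
    (hu0 : ∀ x y, ‖u 0 x - u 0 y‖ ≤ K * dist x y ^ α) (x y : X) :
    ‖v x - v y‖ ≤ (K + ∑' n, h n) * dist x y ^ α := by
  have hpartial (N : ℕ) :
      ‖u N x - u N y‖ ≤ (K + ∑ n ∈ range N, h n) * dist x y ^ α := by
    induction N with
    | zero => simpa using hu0 x y
    | succ N ih =>
      have hsplit : u (N + 1) x - u (N + 1) y =
          (u N x - u N y) + ((u (N + 1) x - u N x) - (u (N + 1) y - u N y)) := by abel
      rw [hsplit, sum_range_succ, ← add_assoc, add_mul]
      exact (norm_add_le _ _).trans (add_le_add ih (hu N x y))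
  refine le_of_tendsto ((huv x).sub (huv y)).norm (Eventually.of_forall fun N => ?_)
  refine (hpartial N).trans ?_
  gcongr
  exact hh.sum_le_tsum _ fun n _ => hh0 n

/-- Hölder convergence of an iteration. For M > 0 and 0 < α < 1 there is a
constant C > 0 (depending only on M and α) such that for all a, b > 1, c > 0 with
α < 1/(1+2bc), and every sequence uₙ : X → E with ‖u_{n+1} − u_n‖∞ ≤ M a^(−bⁿ/2) and
Lip(u_{n+1} − u_n) ≤ 2 a^(c b^{n+1}): the Hölder-α seminorm of u_{n+1} − u_n is at most
C a^((αcb − (1−α)/2)bⁿ), the exponent αcb − (1−α)/2 is negative, the series of these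
bounds converges, and uₙ converges uniformly to a limit which is α-Hölder whenever u₀ is. -/
theorem holder_convergence (M α : ℝ) (hM : 0 < M) (hα0 : 0 < α) (hα1 : α < 1) :
    ∃ C : ℝ, 0 < C ∧
      ∀ (a b c : ℝ), 1 < a → 1 < b → 0 < c → α < 1 / (1 + 2 * b * c) →
      ∀ (X : Type) [MetricSpace X] (E : Type) [NormedAddCommGroup E] [NormedSpace ℝ E]
        [CompleteSpace E] (u : ℕ → X → E),
        (∀ n x, ‖u (n + 1) x - u n x‖ ≤ M * a ^ (-(b ^ n) / 2)) →
        (∀ n x y, ‖(u (n + 1) x - u n x) - (u (n + 1) y - u n y)‖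
            ≤ 2 * a ^ (c * b ^ (n + 1)) * dist x y) →
        (∀ n x y, ‖(u (n + 1) x - u n x) - (u (n + 1) y - u n y)‖
            ≤ C * a ^ ((α * c * b - (1 - α) / 2) * b ^ n) * dist x y ^ α) ∧
        (α * c * b - (1 - α) / 2 < 0) ∧
        Summable (fun n : ℕ => C * a ^ ((α * c * b - (1 - α) / 2) * b ^ n)) ∧
        ∃ v : X → E, TendstoUniformly u v Filter.atTop ∧
          ((∃ K : ℝ, ∀ x y, ‖u 0 x - u 0 y‖ ≤ K * dist x y ^ α) →
            ∃ K : ℝ, ∀ x y, ‖v x - v y‖ ≤ K * dist x y ^ α) := by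
  refine ⟨(2 * M) ^ (1 - α) * 2 ^ α, by positivity, ?_⟩
  intro a b c ha hb hc hα X _ E _ _ _ u hsup hlip
  have ha0 : 0 < a := one_pos.trans ha
  have hb0 : 0 < b := one_pos.trans hb
  have hexp : α * c * b - (1 - α) / 2 < 0 := by
    rw [lt_div_iff₀ (by positivity)] at hα
    linarith
  have hsum := (summable_rpow_mul_pow_of_neg ha hb hexp).mul_left ((2 * M) ^ (1 - α) * 2 ^ α)
  have hhol (n : ℕ) (x y : X) : ‖(u (n + 1) x - u n x) - (u (n + 1) y - u n y)‖ ≤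
      (2 * M) ^ (1 - α) * 2 ^ α * a ^ ((α * c * b - (1 - α) / 2) * b ^ n) * dist x y ^ α := by
    refine (norm_sub_le_of_bounded_of_lipschitz (f := fun x => u (n + 1) x - u n x)
      (by positivity) hα0.le hα1.le (hsup n) (hlip n) x y).trans_eq ?_
    have hsplit : (α * c * b - (1 - α) / 2) * b ^ n =
        -(b ^ n) / 2 * (1 - α) + c * b ^ (n + 1) * α := by ring
    rw [← mul_assoc, Real.mul_rpow (x := 2 * M) (by positivity) (by positivity),
      Real.mul_rpow (x := 2) (y := a ^ _) (by positivity) (by positivity), ← Real.rpow_mul ha0.le,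
      ← Real.rpow_mul ha0.le, hsplit, Real.rpow_add ha0]
    ring
  have hsupsum : Summable fun n : ℕ => M * a ^ (-(b ^ n) / 2) := by
    refine ((summable_rpow_mul_pow_of_neg ha hb (s := -1 / 2) (by norm_num)).mul_left M).congr
      fun n => ?_
    ring_nf
  obtain ⟨v, hv⟩ := exists_tendstoUniformly_of_norm_sub_le hsupsum hsup
  exact ⟨hhol, hexp, hsum, v, hv, fun ⟨_, hK⟩ => ⟨_, norm_sub_le_of_tendsto_of_summable hsum
    (fun n => by positivity) hv.tendsto_at hhol hK⟩⟩
end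
end
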